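/- arXiv:2502.09343 — 2 statements merged into one kernel-verified Lean document; each statement's English description precedes it below -/
import Mathlib

section
/- Let p(x,y) be a symmetric polynomial in two variables over ℚ and let h ≥ 0 be an integer. Then the polynomial p(Δ_x,Δ_y)·sgt_h(x,y) is a ℚ-linear combination of the polynomials sgt_g(x,y) for 0 ≤ g ≤ h. -/
open MvPolynomial

noncomputable section

/-- The polynomial `sgt_h(x,y) = (-1)^h (1/(2h)!) (x-y-h+1)_{2h-1} (x-y)` (and `sgt_0 = 1`),
as a polynomial in the two variables `X 0 = x` and `X 1 = y`. -/
def sgtF (h : ℕ) : MvPolynomial (Fin 2) ℚ :=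
  if h = 0 then 1
  else ((-1 : ℚ) ^ h / (2 * h).factorial) •
    ((∏ j ∈ Finset.range (2 * h - 1),
        (X 0 - X 1 - (h : MvPolynomial (Fin 2) ℚ) + 1 + (j : MvPolynomial (Fin 2) ℚ))) *
      (X 0 - X 1))

/-- The shift operator `E_s` on polynomials: substitute `X s + 1` for `X s`. -/
def shiftF {σ : Type*} [DecidableEq σ] (s : σ) (p : MvPolynomial σ ℚ) : MvPolynomial σ ℚ :=
  MvPolynomial.aeval (fun t => if t = s then MvPolynomial.X t + 1 else MvPolynomial.X t) p

/-- The forward difference operator `Δ_s = E_s - id`. -/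
def fdiffF {σ : Type*} [DecidableEq σ] (s : σ) (p : MvPolynomial σ ℚ) : MvPolynomial σ ℚ :=
  shiftF s p - p

/-- The operator `p(Δ_x, Δ_y)` obtained by substituting the commuting difference operators
`Δ_x = Δ_{X 0}` and `Δ_y = Δ_{X 1}` for the two arguments of the polynomial `p`. -/
def opDiff (p : MvPolynomial (Fin 2) ℚ) (q : MvPolynomial (Fin 2) ℚ) : MvPolynomial (Fin 2) ℚ :=
  ∑ d ∈ p.support, p.coeff d • (fdiffF (0 : Fin 2))^[d 0] ((fdiffF (1 : Fin 2))^[d 1] q)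

/-- If `x`, `y` commute and a subalgebra contains `x + y` and `x * y`, it contains the
power sums of `x` and `y`. -/
lemma pow_add_pow_mem {R A : Type*} [CommRing R] [Ring A] [Algebra R A] (S : Subalgebra R A)
    {x y : A} (hxy : Commute x y) (hadd : x + y ∈ S) (hmul : x * y ∈ S) (n : ℕ) :
    x ^ n + y ^ n ∈ S := by
  induction n using Nat.strong_induction_on with
  | _ n ih =>
    match n with
    | 0 => simpa using S.add_mem S.one_mem S.one_mem
    | 1 => simpa using hadd
    | n + 2 =>
      have key : x ^ (n + 2) + y ^ (n + 2)
          = (x + y) * (x ^ (n + 1) + y ^ (n + 1)) - x * y * (x ^ n + y ^ n) := by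
        have h₁ : x * y * x ^ n = y * x ^ (n + 1) := by
          rw [hxy.eq, mul_assoc, pow_succ']
        have h₂ : x * y * y ^ n = x * y ^ (n + 1) := by rw [mul_assoc, pow_succ']
        rw [mul_add, add_mul, add_mul, mul_add, h₁, h₂, ← pow_succ', ← pow_succ']
        abel
      rw [key]
      exact S.sub_mem (S.mul_mem hadd (ih _ (by omega))) (S.mul_mem hmul (ih _ (by omega)))

/-- If `x`, `y` commute and a subalgebra contains `x + y` and `x * y`, it contains the
symmetrized monomials in `x` and `y`. -/
lemma symmetrized_monomial_mem {R A : Type*} [CommRing R] [Ring A] [Algebra R A]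
    (S : Subalgebra R A) {x y : A} (hxy : Commute x y) (hadd : x + y ∈ S) (hmul : x * y ∈ S)
    (a b : ℕ) : x ^ a * y ^ b + x ^ b * y ^ a ∈ S := by
  wlog hab : a ≤ b generalizing a b
  · rw [add_comm]
    exact this b a (by omega)
  obtain ⟨n, rfl⟩ := Nat.exists_eq_add_of_le hab
  have key : x ^ a * y ^ (a + n) + x ^ (a + n) * y ^ a = (x * y) ^ a * (x ^ n + y ^ n) := by
    rw [hxy.mul_pow, mul_add, pow_add, pow_add, mul_assoc, mul_assoc, mul_assoc,
      (hxy.pow_pow n a).eq, add_comm]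
  rw [key]
  exact S.mul_mem (S.pow_mem hmul a) (pow_add_pow_mem S hxy hadd hmul n)

/-- The algebra of endomorphisms that map a given submodule to itself. -/
def endPreserving {R M : Type*} [CommRing R] [AddCommGroup M] [Module R M]
    (V : Submodule R M) : Subalgebra R (Module.End R M) where
  carrier := {f | ∀ v ∈ V, f v ∈ V}
  mul_mem' hf hg v hv := hf _ (hg v hv)
  add_mem' hf hg v hv := V.add_mem (hf v hv) (hg v hv)
  algebraMap_mem' r _ hv := V.smul_mem r hv

/-- The shift operator as an algebra homomorphism. -/
def shiftHom (s : Fin 2) : MvPolynomial (Fin 2) ℚ →ₐ[ℚ] MvPolynomial (Fin 2) ℚ :=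
  aeval fun t => if t = s then X t + 1 else X t

/-- The forward difference operator as a linear endomorphism. -/
def diffEnd (s : Fin 2) : Module.End ℚ (MvPolynomial (Fin 2) ℚ) :=
  (shiftHom s).toLinearMap - 1

lemma coe_diffEnd (s : Fin 2) : ⇑(diffEnd s) = fdiffF s := rfl

lemma diffEnd_apply (s : Fin 2) (q : MvPolynomial (Fin 2) ℚ) :
    diffEnd s q = shiftHom s q - q := rfl

lemma shiftHom_comm (q : MvPolynomial (Fin 2) ℚ) :
    shiftHom 0 (shiftHom 1 q) = shiftHom 1 (shiftHom 0 q) := by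
  have : (shiftHom 0).comp (shiftHom 1) = (shiftHom 1).comp (shiftHom 0) := by
    ext i : 1
    fin_cases i <;> simp [shiftHom]
  exact DFunLike.congr_fun this q

lemma commute_diffEnd : Commute (diffEnd 0) (diffEnd 1) := by
  refine LinearMap.ext fun q => ?_
  simp only [Module.End.mul_apply, diffEnd_apply, map_sub, shiftHom_comm]
  abel

lemma sgtF_zero : sgtF 0 = 1 := by simp [sgtF]

lemma sgtF_succ (k : ℕ) : sgtF (k + 1) = ((-1 : ℚ) ^ (k + 1) / (2 * (k + 1)).factorial) •
    ((∏ j ∈ Finset.range (2 * k + 1),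
        (X 0 - X 1 - (k : MvPolynomial (Fin 2) ℚ) + (j : MvPolynomial (Fin 2) ℚ))) *
      (X 0 - X 1)) := by
  rw [sgtF, if_neg k.succ_ne_zero, show 2 * (k + 1) - 1 = 2 * k + 1 by omega]
  congr 2
  refine Finset.prod_congr rfl fun j _ => ?_
  push_cast
  ring

lemma shiftHom_zero_sub : shiftHom 0 (X 0 - X 1) = X 0 - X 1 + 1 := by
  simp [shiftHom]
  ring

lemma shiftHom_one_sub : shiftHom 1 (X 0 - X 1) = X 0 - X 1 - 1 := by
  simp [shiftHom]
  ring

/-- The second central difference of the central factorial `t ∏_{|i| ≤ m+1} (t + i)`. -/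
lemma central_second_difference {A : Type*} [CommRing A] (t : A) (m : ℕ) :
    (∏ j ∈ Finset.range (2 * (m + 1) + 1), (t + 1 - ((m + 1 : ℕ) : A) + j)) * (t + 1)
      + (∏ j ∈ Finset.range (2 * (m + 1) + 1), (t - 1 - ((m + 1 : ℕ) : A) + j)) * (t - 1)
      - 2 * ((∏ j ∈ Finset.range (2 * (m + 1) + 1), (t - ((m + 1 : ℕ) : A) + j)) * t)
    = (2 * m + 4) * (2 * m + 3)
      * ((∏ j ∈ Finset.range (2 * m + 1), (t - (m : A) + j)) * t) := by
  have h₁ : ∏ j ∈ Finset.range (2 * (m + 1) + 1), (t + 1 - ((m + 1 : ℕ) : A) + j)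
      = (∏ j ∈ Finset.range (2 * m + 1), (t - (m : A) + j)) * (t + m + 1) * (t + m + 2) := by
    rw [show 2 * (m + 1) + 1 = 2 * m + 1 + 1 + 1 by ring, Finset.prod_range_succ,
      Finset.prod_range_succ]
    congr 1
    · congr 1
      · refine Finset.prod_congr rfl fun j _ => ?_
        push_cast
        ring
      · push_cast
        ring
    · push_cast
      ring
  have h₂ : ∏ j ∈ Finset.range (2 * (m + 1) + 1), (t - 1 - ((m + 1 : ℕ) : A) + j)
      = (∏ j ∈ Finset.range (2 * m + 1), (t - (m : A) + j)) * (t - m - 1) * (t - m - 2) := by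
    rw [show 2 * (m + 1) + 1 = 2 * m + 1 + 1 + 1 by ring, Finset.prod_range_succ',
      Finset.prod_range_succ']
    congr 1
    · congr 1
      · refine Finset.prod_congr rfl fun j _ => ?_
        push_cast
        ring
      · push_cast
        ring
    · push_cast
      ring
  have h₃ : ∏ j ∈ Finset.range (2 * (m + 1) + 1), (t - ((m + 1 : ℕ) : A) + j)
      = (∏ j ∈ Finset.range (2 * m + 1), (t - (m : A) + j)) * (t + m + 1) * (t - m - 1) := by
    rw [show 2 * (m + 1) + 1 = 2 * m + 1 + 1 + 1 by ring, Finset.prod_range_succ',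
      Finset.prod_range_succ]
    congr 1
    · congr 1
      · refine Finset.prod_congr rfl fun j _ => ?_
        push_cast
        ring
      · push_cast
        ring
    · push_cast
      ring
  rw [h₁, h₂, h₃]
  ring

lemma diffEnd_add_sgtF_zero : (diffEnd 0 + diffEnd 1) (sgtF 0) = 0 := by
  simp [sgtF_zero, diffEnd_apply]

lemma diffEnd_add_sgtF_succ (k : ℕ) : (diffEnd 0 + diffEnd 1) (sgtF (k + 1)) = -sgtF k := by
  have hd : ∀ q : MvPolynomial (Fin 2) ℚ,
      (diffEnd 0 + diffEnd 1) q = shiftHom 0 q + shiftHom 1 q - 2 * q := fun q => by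
    simp only [LinearMap.add_apply, diffEnd_apply]
    ring
  rw [sgtF_succ, map_smul, hd]
  simp only [map_mul, map_prod, map_add, map_natCast, map_sub (shiftHom _) _ (Nat.cast _),
    shiftHom_zero_sub, shiftHom_one_sub]
  cases k with
  | zero =>
    have h2 : ∀ t : MvPolynomial (Fin 2) ℚ,
        (t + 1) * (t + 1) + (t - 1) * (t - 1) - 2 * (t * t) = (2 : ℚ) • 1 := fun t => by
      rw [ofNat_smul_eq_nsmul, two_nsmul]
      ring
    simp [sgtF_zero, h2, smul_smul]
  | succ m =>
    have hc : (2 * (m : MvPolynomial (Fin 2) ℚ) + 4) * (2 * (m : MvPolynomial (Fin 2) ℚ) + 3)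
        = C ((2 * (m : ℚ) + 4) * (2 * m + 3)) := by
      simp only [map_mul, map_add, map_natCast, map_ofNat]
    rw [central_second_difference, sgtF_succ, hc, ← smul_eq_C_mul, smul_smul, ← neg_smul]
    congr 1
    rw [show 2 * (m + 1 + 1) = 2 * (m + 1) + 1 + 1 by ring, Nat.factorial_succ,
      Nat.factorial_succ]
    have := Nat.factorial_ne_zero (2 * (m + 1))
    push_cast
    field_simp
    ring

lemma shiftHom_shiftHom_sgtF (h : ℕ) : shiftHom 0 (shiftHom 1 (sgtF h)) = sgtF h := by
  cases h with
  | zero => simp [sgtF_zero]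
  | succ k =>
    rw [sgtF_succ]
    simp only [map_smul, map_mul, map_prod, map_add, map_natCast, map_one,
      map_sub (shiftHom _) _ (Nat.cast _), map_sub (shiftHom _) _ 1,
      shiftHom_zero_sub, shiftHom_one_sub, add_sub_cancel_right]

lemma diffEnd_mul_sgtF (h : ℕ) :
    (diffEnd 0 * diffEnd 1) (sgtF h) = -(diffEnd 0 + diffEnd 1) (sgtF h) := by
  simp only [Module.End.mul_apply, LinearMap.add_apply, diffEnd_apply, map_sub,
    shiftHom_shiftHom_sgtF]
  ring

/-- The span of `sgt_0, …, sgt_h`. -/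
def sgtSpan (h : ℕ) : Submodule ℚ (MvPolynomial (Fin 2) ℚ) :=
  Submodule.span ℚ (sgtF '' (Finset.range (h + 1) : Set ℕ))

lemma sgtF_mem_sgtSpan {g h : ℕ} (hg : g ≤ h) : sgtF g ∈ sgtSpan h :=
  Submodule.subset_span ⟨g, by simpa using Nat.lt_succ_of_le hg, rfl⟩

lemma mem_endPreserving_sgtSpan {h : ℕ} {f : Module.End ℚ (MvPolynomial (Fin 2) ℚ)}
    (hf : ∀ g ≤ h, f (sgtF g) ∈ sgtSpan h) : f ∈ endPreserving (sgtSpan h) := by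
  suffices sgtSpan h ≤ (sgtSpan h).comap f from this
  refine Submodule.span_le.2 ?_
  rintro _ ⟨g, hg, rfl⟩
  exact hf g (by simpa [Nat.lt_succ_iff] using hg)

lemma diffEnd_add_sgtF_mem {g h : ℕ} (hg : g ≤ h) :
    (diffEnd 0 + diffEnd 1) (sgtF g) ∈ sgtSpan h := by
  cases g with
  | zero =>
    rw [diffEnd_add_sgtF_zero]
    exact zero_mem _
  | succ k =>
    rw [diffEnd_add_sgtF_succ]
    exact neg_mem (sgtF_mem_sgtSpan (by omega))

/-- `opDiff` as a linear map in the polynomial of operators. -/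
def opDiffLinear (q : MvPolynomial (Fin 2) ℚ) :
    MvPolynomial (Fin 2) ℚ →ₗ[ℚ] MvPolynomial (Fin 2) ℚ :=
  (basisMonomials (Fin 2) ℚ).constr ℚ fun d => (diffEnd 0 ^ d 0 * diffEnd 1 ^ d 1) q

lemma opDiffLinear_monomial (q : MvPolynomial (Fin 2) ℚ) (d : Fin 2 →₀ ℕ) (a : ℚ) :
    opDiffLinear q (monomial d a) = a • (diffEnd 0 ^ d 0 * diffEnd 1 ^ d 1) q := by
  rw [← mul_one a, ← smul_eq_mul, ← smul_monomial, map_smul, opDiffLinear,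
    ← congrFun (coe_basisMonomials (Fin 2) ℚ) d, Module.Basis.constr_basis, smul_eq_mul, mul_one]

lemma opDiff_eq_opDiffLinear (p q : MvPolynomial (Fin 2) ℚ) :
    opDiff p q = opDiffLinear q p := by
  conv_rhs => rw [p.as_sum]
  simp only [map_sum, opDiffLinear_monomial, opDiff, Module.End.mul_apply, Module.End.pow_apply,
    coe_diffEnd]

lemma opDiffLinear_symmetrized_mem (h : ℕ) (p : MvPolynomial (Fin 2) ℚ) :
    opDiffLinear (sgtF h) (p + rename (⇑(Equiv.swap (0 : Fin 2) 1)) p) ∈ sgtSpan h := by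
  induction p using MvPolynomial.induction_on' with
  | monomial d a =>
    have h0 : d.mapDomain (Equiv.swap (0 : Fin 2) 1) 0 = d 1 := by
      simp
    have h1 : d.mapDomain (Equiv.swap (0 : Fin 2) 1) 1 = d 0 := by
      simp
    rw [rename_monomial, map_add, opDiffLinear_monomial, opDiffLinear_monomial, h0, h1,
      ← smul_add, ← LinearMap.add_apply]
    have hadd : diffEnd 0 + diffEnd 1 ∈ endPreserving (sgtSpan h) :=
      mem_endPreserving_sgtSpan fun g hg => diffEnd_add_sgtF_mem hg
    have hmul : diffEnd 0 * diffEnd 1 ∈ endPreserving (sgtSpan h) :=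
      mem_endPreserving_sgtSpan fun g hg => by
        rw [diffEnd_mul_sgtF]
        exact neg_mem (diffEnd_add_sgtF_mem hg)
    exact Submodule.smul_mem _ _ (symmetrized_monomial_mem _ commute_diffEnd hadd hmul _ _ _
      (sgtF_mem_sgtSpan le_rfl))
  | add p q hp hq =>
    rw [map_add (rename _), add_add_add_comm, map_add]
    exact add_mem hp hq

/-- If `p(x,y)` is a symmetric polynomial and `h ≥ 0`, then
`p(Δ_x,Δ_y) sgt_h(x,y)` is a `ℚ`-linear combination of the `sgt_g(x,y)` for `0 ≤ g ≤ h`. -/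
theorem statement9 (p : MvPolynomial (Fin 2) ℚ)
    (hp : rename (⇑(Equiv.swap (0 : Fin 2) 1)) p = p) (h : ℕ) :
    ∃ c : ℕ → ℚ, opDiff p (sgtF h) = ∑ g ∈ Finset.range (h + 1), c g • sgtF g := by
  have hmem : opDiff p (sgtF h) ∈ sgtSpan h := by
    have h2 := opDiffLinear_symmetrized_mem h p
    rw [hp, ← two_smul ℚ p, map_smul] at h2
    rw [opDiff_eq_opDiffLinear]
    exact ((sgtSpan h).smul_mem_iff two_ne_zero).1 h2
  obtain ⟨c, hc⟩ := Submodule.mem_span_image_finset_iff_exists_fun' ℚ |>.1 hmem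
  exact ⟨c, hc.symm⟩
end
end

section
/- Define polynomials G(h_1,h_2) ∈ ℚ[x_1,y_1,x_2,y_2] for all integers h_1,h_2 by: G(h_1,h_2) = 0 if h_1 < 0 or h_2 < 0, and otherwise G(h_1,h_2) = sgt_{h_1}(x_1,y_1)·sgt_{h_2}(x_2,y_2) + 3·G(h_1−1,h_2−1) − G(h_1−1,h_2−2) − G(h_1−2,h_2−1). Then for all integers h_1,h_2: W_{x_1,x_2} W_{y_1,x_2} W_{x_1,y_2} W_{y_1,y_2} G(h_1,h_2) = sgt_{h_1}(x_1,y_1) · sgt_{h_2}(x_2,y_2). Equivalently, W^{−1}_{x_1,x_2} W^{−1}_{y_1,x_2} W^{−1}_{x_1,y_2} W^{−1}_{y_1,y_2} (sgt_{h_1}(x_1,y_1) sgt_{h_2}(x_2,y_2)) = G(h_1,h_2). -/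
open MvPolynomial

noncomputable section

/-- The polynomial `sgt_h(u,v)` in the variables `X u` and `X v` (with `sgt_0 = 1` and
`sgt_h = 0` for `h < 0`). -/
def sgtQ (h : ℤ) (u v : ℕ) : MvPolynomial ℕ ℚ :=
  if h < 0 then 0
  else if h = 0 then 1
  else ((-1 : ℚ) ^ h.toNat / (2 * h.toNat).factorial) •
    ((∏ j ∈ Finset.range (2 * h.toNat - 1),
        (X u - X v - (h : MvPolynomial ℕ ℚ) + 1 + (j : MvPolynomial ℕ ℚ))) *
      (X u - X v))

/-- The shift operator `E_s` on polynomials: substitute `X s + 1` for `X s`. -/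
def shiftV (s : ℕ) (p : MvPolynomial ℕ ℚ) : MvPolynomial ℕ ℚ :=
  MvPolynomial.aeval (fun t => if t = s then MvPolynomial.X t + 1 else MvPolynomial.X t) p

/-- The forward difference operator `Δ_s = E_s - id`. -/
def fdiffV (s : ℕ) (p : MvPolynomial ℕ ℚ) : MvPolynomial ℕ ℚ :=
  shiftV s p - p

/-- The operator `W_{x,y} = id + Δ_x + Δ_x Δ_y`. -/
def Wop (x y : ℕ) (p : MvPolynomial ℕ ℚ) : MvPolynomial ℕ ℚ :=
  p + fdiffV x p + fdiffV x (fdiffV y p)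

/-- The polynomial function `∏_{j < 2n+1} (z - n + j)`. -/
def centeredProd {R : Type*} [CommRing R] (n : ℕ) (z : R) : R :=
  ∏ j ∈ Finset.range (2 * n + 1), (z - n + j)

section CenteredProd

variable {R : Type*} [CommRing R]

theorem centeredProd_succ (n : ℕ) (z : R) :
    centeredProd (n + 1) z = (z - n - 1) * centeredProd n z * (z + n + 1) := by
  unfold centeredProd
  rw [show 2 * (n + 1) + 1 = 2 * n + 1 + 1 + 1 by ring, Finset.prod_range_succ,
    Finset.prod_range_succ']
  have h : ∀ j ∈ Finset.range (2 * n + 1),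
      (z - ((n + 1 : ℕ) : R) + ((j + 1 : ℕ) : R)) = z - n + j := by
    intro j _; push_cast; ring
  rw [Finset.prod_congr rfl h]
  push_cast
  ring

theorem centeredProd_succ_add_one (n : ℕ) (z : R) :
    centeredProd (n + 1) (z + 1) = centeredProd n z * (z + n + 1) * (z + n + 2) := by
  unfold centeredProd
  rw [show 2 * (n + 1) + 1 = 2 * n + 1 + 1 + 1 by ring, Finset.prod_range_succ,
    Finset.prod_range_succ]
  have h : ∀ j ∈ Finset.range (2 * n + 1),
      (z + 1 - ((n + 1 : ℕ) : R) + (j : R)) = z - n + j := by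
    intro j _; push_cast; ring
  rw [Finset.prod_congr rfl h]
  push_cast
  ring

theorem centeredProd_succ_sub_one (n : ℕ) (z : R) :
    centeredProd (n + 1) (z - 1) = (z - n - 2) * (z - n - 1) * centeredProd n z := by
  unfold centeredProd
  rw [show 2 * (n + 1) + 1 = 2 * n + 1 + 1 + 1 by ring, Finset.prod_range_succ',
    Finset.prod_range_succ']
  have h : ∀ j ∈ Finset.range (2 * n + 1),
      (z - 1 - ((n + 1 : ℕ) : R) + ((j + 1 + 1 : ℕ) : R)) = z - n + j := by
    intro j _; push_cast; ring
  rw [Finset.prod_congr rfl h]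
  push_cast
  ring

theorem centeredProd_mul_second_difference (n : ℕ) (z : R) :
    centeredProd (n + 1) (z + 1) * (z + 1) + centeredProd (n + 1) (z - 1) * (z - 1)
      - 2 * (centeredProd (n + 1) z * z) =
      ((2 * n + 4) * (2 * n + 3)) * (centeredProd n z * z) := by
  rw [centeredProd_succ_add_one, centeredProd_succ_sub_one, centeredProd_succ]
  ring

theorem map_centeredProd {S F : Type*} [CommRing S] [FunLike F R S] [RingHomClass F R S]
    (f : F) (n : ℕ) (z : R) : f (centeredProd n z) = centeredProd n (f z) := by
  simp [centeredProd, map_prod]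

end CenteredProd

theorem sgtQ_natCast_succ (n : ℕ) (u v : ℕ) :
    sgtQ ((n : ℤ) + 1) u v = ((-1 : ℚ) ^ (n + 1) / (2 * (n + 1)).factorial) •
      (centeredProd n (X u - X v) * (X u - X v)) := by
  have hn : ((n : ℤ) + 1).toNat = n + 1 := by omega
  rw [sgtQ, if_neg (by omega), if_neg (by omega), hn]
  congr 2
  unfold centeredProd
  rw [show 2 * (n + 1) - 1 = 2 * n + 1 by omega]
  refine Finset.prod_congr rfl fun j _ => ?_
  push_cast
  ring

theorem sgtQ_zero (u v : ℕ) : sgtQ 0 u v = 1 := by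
  simp [sgtQ]

theorem sgtQ_of_neg {h : ℤ} (hh : h < 0) (u v : ℕ) : sgtQ h u v = 0 := by
  simp [sgtQ, hh]

theorem int_cases_neg_zero_succ (h : ℤ) : h < 0 ∨ h = 0 ∨ ∃ n : ℕ, h = (n : ℤ) + 1 := by
  rcases lt_trichotomy h 0 with h0 | h0 | h0
  · exact Or.inl h0
  · exact Or.inr (Or.inl h0)
  · exact Or.inr (Or.inr ⟨(h - 1).toNat, by omega⟩)

section Shift

variable (s t : ℕ) (p q : MvPolynomial ℕ ℚ)

theorem shiftV_add : shiftV s (p + q) = shiftV s p + shiftV s q := map_add _ _ _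

theorem shiftV_sub : shiftV s (p - q) = shiftV s p - shiftV s q := map_sub _ _ _

theorem shiftV_mul : shiftV s (p * q) = shiftV s p * shiftV s q := map_mul _ _ _

theorem shiftV_nsmul (n : ℕ) : shiftV s (n • p) = n • shiftV s p := map_nsmul _ _ _

theorem shiftV_smul (c : ℚ) : shiftV s (c • p) = c • shiftV s p := map_smul _ _ _

theorem shiftV_zero : shiftV s 0 = 0 := map_zero _

theorem shiftV_one : shiftV s 1 = 1 := map_one _

theorem shiftV_centeredProd (n : ℕ) :
    shiftV s (centeredProd n p) = centeredProd n (shiftV s p) :=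
  map_centeredProd _ _ _

theorem shiftV_X : shiftV s (X t) = if t = s then X t + 1 else X t := by
  simp [shiftV]

theorem shiftV_comm : shiftV s (shiftV t p) = shiftV t (shiftV s p) := by
  induction p using MvPolynomial.induction_on with
  | C a => simp [shiftV]
  | add p q hp hq => simp only [shiftV_add, hp, hq]
  | mul_X p i hp =>
    simp only [shiftV_mul, hp, shiftV_X]
    congr 1
    split_ifs <;> simp only [shiftV_add, shiftV_one, shiftV_X] <;> split_ifs <;> rfl

end Shift

section ShiftSgt

variable (h : ℤ) {u v w : ℕ}

theorem shiftV_sgtQ_of_ne (hu : u ≠ w) (hv : v ≠ w) :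
    shiftV w (sgtQ h u v) = sgtQ h u v := by
  rcases int_cases_neg_zero_succ h with hh | rfl | ⟨n, rfl⟩
  · rw [sgtQ_of_neg hh, shiftV_zero]
  · rw [sgtQ_zero, shiftV_one]
  · simp only [sgtQ_natCast_succ, shiftV_smul, shiftV_mul, shiftV_centeredProd, shiftV_sub,
      shiftV_X, if_neg hu, if_neg hv]

theorem shiftV_shiftV_sgtQ (huv : u ≠ v) :
    shiftV u (shiftV v (sgtQ h u v)) = sgtQ h u v := by
  rcases int_cases_neg_zero_succ h with hh | rfl | ⟨n, rfl⟩
  · simp only [sgtQ_of_neg hh, shiftV_zero]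
  · simp only [sgtQ_zero, shiftV_one]
  · simp only [sgtQ_natCast_succ, shiftV_smul, shiftV_mul, shiftV_centeredProd, shiftV_sub,
      shiftV_add, shiftV_one, shiftV_X, if_neg huv, if_neg huv.symm, if_true,
      add_sub_add_right_eq_sub]

theorem sgtQ_second_difference (huv : u ≠ v) :
    shiftV u (sgtQ h u v) + shiftV v (sgtQ h u v) - 2 • sgtQ h u v = - sgtQ (h - 1) u v := by
  rcases int_cases_neg_zero_succ h with hh | rfl | ⟨n, rfl⟩
  · simp [sgtQ_of_neg hh, sgtQ_of_neg (show h - 1 < 0 by omega), shiftV_zero]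
  · rw [sgtQ_of_neg (show (0 : ℤ) - 1 < 0 by omega), sgtQ_zero, shiftV_one, shiftV_one]
    norm_num
  · have hz : (X u - (X v + 1) : MvPolynomial ℕ ℚ) = X u - X v - 1 := by ring
    have hz' : (X u + 1 - X v : MvPolynomial ℕ ℚ) = X u - X v + 1 := by ring
    simp only [sgtQ_natCast_succ, shiftV_smul, shiftV_mul, shiftV_centeredProd, shiftV_sub,
      shiftV_X, if_neg huv, if_neg huv.symm, if_true, add_sub_cancel_right, hz, hz']
    rw [smul_comm (2 : ℕ), ← smul_add, ← smul_sub, nsmul_eq_mul]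
    cases n with
    | zero =>
      simp only [Nat.cast_zero, sgtQ_zero, centeredProd]
      have h2 : (-1 : MvPolynomial ℕ ℚ) = (-1 / 2 : ℚ) • 2 := by
        rw [MvPolynomial.smul_eq_C_mul, ← map_ofNat C 2, ← map_mul]
        norm_num
      rw [h2]
      norm_num
      ring
    | succ n =>
      rw [Nat.cast_ofNat, centeredProd_mul_second_difference, Nat.cast_succ, sgtQ_natCast_succ]
      have hc : ((2 * n + 4) * (2 * n + 3) : MvPolynomial ℕ ℚ) =
          C ((2 * n + 4) * (2 * n + 3) : ℚ) := by
        simp only [map_mul, map_add, map_ofNat, map_natCast]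
      rw [hc, ← MvPolynomial.smul_eq_C_mul, smul_smul, ← neg_smul]
      congr 1
      rw [show 2 * (n + 1 + 1) = 2 * (n + 1) + 1 + 1 by ring, Nat.factorial_succ,
        Nat.factorial_succ]
      have hf : ((2 * (n + 1)).factorial : ℚ) ≠ 0 := by positivity
      push_cast
      field_simp
      ring

end ShiftSgt

section Wop

variable (x y : ℕ) (p q : MvPolynomial ℕ ℚ)

theorem Wop_eq : Wop x y p = p - shiftV y p + shiftV x (shiftV y p) := by
  simp only [Wop, fdiffV, shiftV_sub]
  abel

theorem Wop_add : Wop x y (p + q) = Wop x y p + Wop x y q := by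
  simp only [Wop_eq, shiftV_add]
  abel

theorem Wop_sub : Wop x y (p - q) = Wop x y p - Wop x y q := by
  simp only [Wop_eq, shiftV_sub]
  abel

theorem Wop_shiftV (t : ℕ) : Wop x y (shiftV t p) = shiftV t (Wop x y p) := by
  simp only [Wop_eq, shiftV_sub, shiftV_add, shiftV_comm t]

variable {x p q} in
/-- If `p` is invariant under simultaneous shifts of `x` and `x'`, then `W_{x,y} W_{x',y}` acts
on it through the second difference. -/
theorem Wop_Wop_eq {x' : ℕ} (hp : shiftV x (shiftV x' p) = p)
    (hq : shiftV x p + shiftV x' p - 2 • p = -q) :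
    Wop x y (Wop x' y p) = p - shiftV y q + shiftV y (shiftV y q) := by
  have hq' : q = 2 • p - shiftV x p - shiftV x' p := by rw [← neg_neg q, ← hq]; abel
  subst hq'
  simp only [Wop_eq, shiftV_sub, shiftV_add, shiftV_nsmul, shiftV_comm x y, shiftV_comm x' y, hp]
  abel

end Wop

/-- Induction principle for a recursion that decreases both indices. -/
theorem int_pair_induction {P : ℤ → ℤ → Prop} (hneg : ∀ a b, a < 0 ∨ b < 0 → P a b)
    (hstep : ∀ a b, P (a - 1) (b - 1) → P (a - 1) (b - 2) → P (a - 2) (b - 1) → P a b)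
    (a b : ℤ) : P a b := by
  have key : ∀ n : ℕ, ∀ a b : ℤ, a < n → P a b := by
    intro n
    induction n with
    | zero => exact fun a b ha => hneg a b (Or.inl (by simpa using ha))
    | succ n ih =>
      intro a b ha
      push_cast at ha
      exact hstep a b (ih _ _ (by omega)) (ih _ _ (by omega)) (ih _ _ (by omega))
  exact key (a.toNat + 1) a b (by omega)

/-- Let `G : ℤ → ℤ → ℚ[x_1,y_1,x_2,y_2]` (variables `x_1 = X 0`,
`y_1 = X 1`, `x_2 = X 2`, `y_2 = X 3`) be the family of polynomials defined by the
recursion `G(h_1,h_2) = 0` if `h_1 < 0` or `h_2 < 0`, and otherwise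
`G(h_1,h_2) = sgt_{h_1}(x_1,y_1) sgt_{h_2}(x_2,y_2) + 3 G(h_1-1,h_2-1) - G(h_1-1,h_2-2)
- G(h_1-2,h_2-1)`.  Then for all integers `h_1, h_2`:
`W_{x_1,x_2} W_{y_1,x_2} W_{x_1,y_2} W_{y_1,y_2} G(h_1,h_2)
  = sgt_{h_1}(x_1,y_1) sgt_{h_2}(x_2,y_2)`. -/
theorem statement11 (G : ℤ → ℤ → MvPolynomial ℕ ℚ)
    (hG0 : ∀ h1 h2 : ℤ, h1 < 0 ∨ h2 < 0 → G h1 h2 = 0)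
    (hGrec : ∀ h1 h2 : ℤ, 0 ≤ h1 → 0 ≤ h2 →
      G h1 h2 = sgtQ h1 0 1 * sgtQ h2 2 3 + 3 • G (h1 - 1) (h2 - 1)
        - G (h1 - 1) (h2 - 2) - G (h1 - 2) (h2 - 1)) :
    ∀ h1 h2 : ℤ,
      Wop 0 2 (Wop 1 2 (Wop 0 3 (Wop 1 3 (G h1 h2)))) = sgtQ h1 0 1 * sgtQ h2 2 3 := by
  intro h1 h2
  have hrec : ∀ a b : ℤ, G a b = sgtQ a 0 1 * sgtQ b 2 3 + 3 • G (a - 1) (b - 1)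
      - G (a - 1) (b - 2) - G (a - 2) (b - 1) := by
    intro a b
    rcases lt_or_ge a 0 with ha | ha
    · simp [hG0 _ _ (Or.inl ha), sgtQ_of_neg ha, hG0 (a - 1) _ (Or.inl (by omega)),
        hG0 (a - 2) _ (Or.inl (by omega))]
    rcases lt_or_ge b 0 with hb | hb
    · simp [hG0 _ _ (Or.inr hb), sgtQ_of_neg hb, hG0 _ (b - 1) (Or.inr (by omega)),
        hG0 _ (b - 2) (Or.inr (by omega))]
    exact hGrec a b ha hb
  have hinv1 : ∀ a b : ℤ, shiftV 0 (shiftV 1 (G a b)) = G a b := by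
    refine int_pair_induction (fun a b h => by simp only [hG0 a b h, shiftV_zero]) ?_
    intro a b i1 i2 i3
    rw [hrec a b]
    simp only [shiftV_sub, shiftV_add, shiftV_nsmul, shiftV_mul, i1, i2, i3,
      shiftV_shiftV_sgtQ a (show 0 ≠ 1 by decide),
      shiftV_sgtQ_of_ne b (show 2 ≠ 1 by decide) (show 3 ≠ 1 by decide),
      shiftV_sgtQ_of_ne b (show 2 ≠ 0 by decide) (show 3 ≠ 0 by decide)]
  have hinv2 : ∀ a b : ℤ, shiftV 2 (shiftV 3 (G a b)) = G a b := by
    refine int_pair_induction (fun a b h => by simp only [hG0 a b h, shiftV_zero]) ?_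
    intro a b i1 i2 i3
    rw [hrec a b]
    simp only [shiftV_sub, shiftV_add, shiftV_nsmul, shiftV_mul, i1, i2, i3,
      shiftV_shiftV_sgtQ b (show 2 ≠ 3 by decide),
      shiftV_sgtQ_of_ne a (show 0 ≠ 2 by decide) (show 1 ≠ 2 by decide),
      shiftV_sgtQ_of_ne a (show 0 ≠ 3 by decide) (show 1 ≠ 3 by decide)]
  have hdiff1 : ∀ a b : ℤ,
      shiftV 0 (G a b) + shiftV 1 (G a b) - 2 • G a b = -G (a - 1) b := by
    refine int_pair_induction (fun a b h => ?_) ?_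
    · simp [hG0 a b h, hG0 (a - 1) b (by omega), shiftV_zero]
    intro a b i1 i2 i3
    rw [hrec a b, hrec (a - 1) b]
    simp only [shiftV_sub, shiftV_add, shiftV_nsmul, shiftV_mul,
      shiftV_sgtQ_of_ne b (show 2 ≠ 1 by decide) (show 3 ≠ 1 by decide),
      shiftV_sgtQ_of_ne b (show 2 ≠ 0 by decide) (show 3 ≠ 0 by decide)]
    rw [show a - 1 - 2 = a - 2 - 1 by ring]
    have hs := sgtQ_second_difference a (show 0 ≠ 1 by decide)
    simp only [nsmul_eq_mul] at *
    linear_combination sgtQ b 2 3 * hs + (3 : ℕ) * i1 - i2 - i3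
  have hdiff2 : ∀ a b : ℤ,
      shiftV 2 (G a b) + shiftV 3 (G a b) - 2 • G a b = -G a (b - 1) := by
    refine int_pair_induction (fun a b h => ?_) ?_
    · simp [hG0 a b h, hG0 a (b - 1) (by omega), shiftV_zero]
    intro a b i1 i2 i3
    rw [hrec a b, hrec a (b - 1)]
    simp only [shiftV_sub, shiftV_add, shiftV_nsmul, shiftV_mul,
      shiftV_sgtQ_of_ne a (show 0 ≠ 2 by decide) (show 1 ≠ 2 by decide),
      shiftV_sgtQ_of_ne a (show 0 ≠ 3 by decide) (show 1 ≠ 3 by decide)]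
    rw [show b - 1 - 2 = b - 2 - 1 by ring]
    have hs := sgtQ_second_difference b (show 2 ≠ 3 by decide)
    simp only [nsmul_eq_mul] at *
    linear_combination sgtQ a 0 1 * hs + (3 : ℕ) * i1 - i2 - i3
  have hWW : ∀ (y : ℕ) (a b : ℤ), Wop 0 y (Wop 1 y (G a b)) =
      G a b - shiftV y (G (a - 1) b) + shiftV y (shiftV y (G (a - 1) b)) :=
    fun y a b => Wop_Wop_eq y (hinv1 a b) (hdiff1 a b)
  rw [hWW 3]
  simp only [Wop_add, Wop_sub, Wop_shiftV, hWW 2]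
  simp only [shiftV_sub, shiftV_add, shiftV_comm 3 2, hinv2]
  have e1 := hdiff2 (h1 - 1) h2
  have e2 := congrArg (shiftV 2) e1
  have e3 := congrArg (shiftV 3) e1
  have e4 := hdiff2 (h1 - 1) (h2 - 1)
  have e5 := hdiff2 (h1 - 1 - 1) h2
  have e6 := hrec h1 h2
  rw [← zero_sub] at e2 e3
  simp only [shiftV_sub, shiftV_add, shiftV_nsmul, shiftV_zero, shiftV_comm 3 2, hinv2] at e2 e3
  rw [show h1 - 1 - 1 = h1 - 2 by ring] at *
  rw [show h2 - 1 - 1 = h2 - 2 by ring] at e4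
  simp only [nsmul_eq_mul] at *
  push_cast at *
  linear_combination e1 + e2 + e3 - e4 - e5 + e6
end
end
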